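/- Let n ≥ 1 and C₀ > 1. There exist constants C₁ > 0 (large) and μ₀ > 0 (small), depending only on n and C₀, such that the following holds. Let w₀ ∈ C³(B₁) (B₁ ⊂ ℂⁿ) satisfy (1/C₀)·I ≤ ((w₀)_{ij̄}(z)) ≤ C₀·I and |D³w₀(z)| ≤ C₀ for all z ∈ B_{0.99}. Let δ ≥ 0 and let φ₀ be a continuous function on B₁ with |φ₀ − w₀| ≤ δ on B_{0.95}. Fix x₀ with |x₀| + 1/(2C₀²) ≤ 0.95, and set a_{ij} = (w₀)_{ij̄}(x₀), h_{x₀}(z) = Re(Σ_i 2·∂w₀/∂z_i(x₀)·(z − x₀)_i) + Re(Σ_{i,j} ∂²w₀/∂z_i∂z_j(x₀)·(z − x₀)_i(z − x₀)_j), and E_μ(x₀) = {z ∈ ℂⁿ : Σ_{i,j} a_{ij}(z − x₀)_i·conj((z − x₀)_j) ≤ μ}. Then for every μ with 4C₁δ ≤ μ ≤ μ₀, setting γ = δ/μ + μ^{1/2} and S = {z ∈ B_{1/(2C₀²)}(x₀) : (φ₀ − h_{x₀})(z) ≤ φ₀(x₀) + μ}, one has (1 − C₁γ)E_μ(x₀)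 ⊂ S ⊂ (1 + C₁γ)E_μ(x₀); moreover (φ₀ − h_{x₀})(z) = φ₀(x₀) + μ for every z ∈ ∂S. -/

import Mathlib

open Metric MeasureTheory ComplexOrder

noncomputable section

/-- Wirtinger derivative `∂f/∂z_i = (1/2)(∂/∂x_i - i ∂/∂y_i)` of `f` at `z`. -/
def wdz (n : ℕ) (f : EuclideanSpace ℂ (Fin n) → ℂ) (i : Fin n)
    (z : EuclideanSpace ℂ (Fin n)) : ℂ :=
  (1 / 2) * (fderiv ℝ f z (EuclideanSpace.single i 1) -
    Complex.I * fderiv ℝ f z (EuclideanSpace.single i Complex.I))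

/-- Conjugate Wirtinger derivative `∂f/∂z̄_j = (1/2)(∂/∂x_j + i ∂/∂y_j)` of `f` at `z`. -/
def wdzbar (n : ℕ) (f : EuclideanSpace ℂ (Fin n) → ℂ) (j : Fin n)
    (z : EuclideanSpace ℂ (Fin n)) : ℂ :=
  (1 / 2) * (fderiv ℝ f z (EuclideanSpace.single j 1) +
    Complex.I * fderiv ℝ f z (EuclideanSpace.single j Complex.I))

/-- Complex Hessian matrix `(φ_{i j̄}(z)) = (∂²φ/∂z_i∂z̄_j(z))` of a real-valued function. -/
def cHess (n : ℕ) (φ : EuclideanSpace ℂ (Fin n) → ℝ) (z : EuclideanSpace ℂ (Fin n)) :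
    Matrix (Fin n) (Fin n) ℂ :=
  Matrix.of fun i j => wdz n (fun w => wdzbar n (fun v => (φ v : ℂ)) j w) i z

/-- Linearized complex Monge–Ampère operator
`L_φ u = det(φ_{k l̄}) · Σ_{i,j} φ^{i j̄} u_{i j̄}`. -/
def Lop (n : ℕ) (φ u : EuclideanSpace ℂ (Fin n) → ℝ) (z : EuclideanSpace ℂ (Fin n)) : ℂ :=
  (cHess n φ z).det * ∑ i, ∑ j, (cHess n φ z)⁻¹ i j * cHess n u z i j

/-- The pluriharmonic polynomial
`h_{x₀}(z) = Re(Σ_i 2 (w₀)_i(x₀) (z−x₀)_i) + Re(Σ_{i,j} (w₀)_{ij}(x₀) (z−x₀)_i (z−x₀)_j)`. -/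
def hpoly (n : ℕ) (w₀ : EuclideanSpace ℂ (Fin n) → ℝ) (x₀ z : EuclideanSpace ℂ (Fin n)) : ℝ :=
  (∑ i, 2 * wdz n (fun v => (w₀ v : ℂ)) i x₀ * (z - x₀) i).re +
  (∑ i, ∑ j, wdz n (fun w => wdz n (fun v => (w₀ v : ℂ)) j w) i x₀ *
    (z - x₀) i * (z - x₀) j).re

/-- The ellipsoid `E_μ(x₀) = {z : Σ_{i,j} a_{ij} (z−x₀)_i conj((z−x₀)_j) ≤ μ}` with
`a_{ij} = (w₀)_{i j̄}(x₀)`. -/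
def Emu (n : ℕ) (w₀ : EuclideanSpace ℂ (Fin n) → ℝ) (x₀ : EuclideanSpace ℂ (Fin n)) (μ : ℝ) :
    Set (EuclideanSpace ℂ (Fin n)) :=
  {z | (∑ i, ∑ j, cHess n w₀ x₀ i j * (z - x₀) i * (starRingEnd ℂ) ((z - x₀) j)) ≤ (μ : ℂ)}

/-- The "section" `S = {z ∈ B_{1/(2C₀²)}(x₀) : (φ₀ − h_{x₀})(z) ≤ φ₀(x₀) + μ}`. -/
def Sset (n : ℕ) (w₀ φ₀ : EuclideanSpace ℂ (Fin n) → ℝ) (x₀ : EuclideanSpace ℂ (Fin n))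
    (μ C₀ : ℝ) : Set (EuclideanSpace ℂ (Fin n)) :=
  {z | z ∈ ball x₀ (1 / (2 * C₀ ^ 2)) ∧ φ₀ z - hpoly n w₀ x₀ z ≤ φ₀ x₀ + μ}

theorem abs_sub_second_taylor_le {E : Type*} [NormedAddCommGroup E] [NormedSpace ℝ E]
    {f : E → ℝ} {x₀ z : E} {R C : ℝ} (hf : ContDiffOn ℝ 3 f (ball x₀ R))
    (hC : ∀ x ∈ ball x₀ R, ‖iteratedFDeriv ℝ 3 f x‖ ≤ C) (hz : z ∈ ball x₀ R) :
    |f z - f x₀ - fderiv ℝ f x₀ (z - x₀)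
        - (1 / 2) * fderiv ℝ (fderiv ℝ f) x₀ (z - x₀) (z - x₀)| ≤ C * ‖z - x₀‖ ^ 3 := by
  set ρ : ℝ := ‖z - x₀‖ with hρ
  have hρR : ρ < R := by simpa [dist_eq_norm] using hz
  have hsub : closedBall x₀ ρ ⊆ ball x₀ R := closedBall_subset_ball hρR
  have hρ0 : 0 ≤ ρ := norm_nonneg _
  have hx₀ : x₀ ∈ closedBall x₀ ρ := mem_closedBall_self hρ0
  have hzρ : z ∈ closedBall x₀ ρ := by simp [dist_eq_norm, hρ]
  have hC0 : 0 ≤ C := (norm_nonneg _).trans (hC z hz)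
  have hf1 : ContDiffOn ℝ 2 (fderiv ℝ f) (ball x₀ R) :=
    hf.fderiv_of_isOpen isOpen_ball (by norm_num)
  have hf2 : ContDiffOn ℝ 1 (fderiv ℝ (fderiv ℝ f)) (ball x₀ R) :=
    hf1.fderiv_of_isOpen isOpen_ball (by norm_num)
  have d0 : ∀ x ∈ ball x₀ R, HasFDerivAt f (fderiv ℝ f x) x := fun x hx =>
    ((hf.contDiffAt (isOpen_ball.mem_nhds hx)).differentiableAt (by norm_num)).hasFDerivAt
  have d1 : ∀ x ∈ ball x₀ R, HasFDerivAt (fderiv ℝ f) (fderiv ℝ (fderiv ℝ f) x) x :=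
    fun x hx =>
    ((hf1.contDiffAt (isOpen_ball.mem_nhds hx)).differentiableAt (by norm_num)).hasFDerivAt
  have d2 : ∀ x ∈ ball x₀ R, HasFDerivAt (fderiv ℝ (fderiv ℝ f))
      (fderiv ℝ (fderiv ℝ (fderiv ℝ f)) x) x := fun x hx =>
    ((hf2.contDiffAt (isOpen_ball.mem_nhds hx)).differentiableAt (by norm_num)).hasFDerivAt
  have hsymm : IsSymmSndFDerivAt ℝ f x₀ :=
    (hf.contDiffAt (isOpen_ball.mem_nhds (hsub hx₀))).isSymmSndFDerivAt (by
      rw [minSmoothness_of_isRCLikeNormedField]; exact_mod_cast (by norm_num : (2 : ℕ) ≤ 3))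
  set B := fderiv ℝ (fderiv ℝ f) x₀ with hB
  have b2 : ∀ x ∈ closedBall x₀ ρ, ‖fderiv ℝ (fderiv ℝ f) x - B‖ ≤ C * ρ := by
    intro x hx
    have h := (convex_closedBall x₀ ρ).norm_image_sub_le_of_norm_hasFDerivWithin_le
      (fun y hy => (d2 y (hsub hy)).hasFDerivWithinAt) (C := C) (fun y hy => by
        have := hC y (hsub hy)
        rwa [← norm_iteratedFDeriv_fderiv, ← norm_iteratedFDeriv_fderiv,
          norm_iteratedFDeriv_one] at this) hx₀ hx
    exact h.trans (mul_le_mul_of_nonneg_left (by simpa [dist_eq_norm] using hx) hC0)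
  have b1 : ∀ x ∈ closedBall x₀ ρ, ‖fderiv ℝ f x - (fderiv ℝ f x₀ + B (x - x₀))‖
      ≤ C * ρ * ρ := by
    intro x hx
    have h := (convex_closedBall x₀ ρ).norm_image_sub_le_of_norm_hasFDerivWithin_le
      (f := fun y => fderiv ℝ f y - B y)
      (fun y hy => ((d1 y (hsub hy)).sub B.hasFDerivAt).hasFDerivWithinAt) (C := C * ρ)
      b2 hx₀ hx
    refine le_trans (le_of_eq ?_)
      (h.trans (mul_le_mul_of_nonneg_left (by simpa [dist_eq_norm] using hx) (by positivity)))
    congr 1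
    simp only [map_sub]
    abel
  have dq : ∀ x, HasFDerivAt (fun y => (1 / 2 : ℝ) * B (y - x₀) (y - x₀)) (B (x - x₀)) x := by
    intro x
    have hs : HasFDerivAt (fun y : E => y - x₀) (ContinuousLinearMap.id ℝ E) x :=
      (hasFDerivAt_id x).sub_const x₀
    have h := (B.hasFDerivAt_of_bilinear hs hs).const_mul (1 / 2 : ℝ)
    refine h.congr_fderiv ?_
    ext u
    have hu : B u (x - x₀) = B (x - x₀) u := hsymm.eq u (x - x₀)
    simp [ContinuousLinearMap.precompR_apply, ContinuousLinearMap.precompL_apply, -map_sub] at hu ⊢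
    linarith
  have h := (convex_closedBall x₀ ρ).norm_image_sub_le_of_norm_hasFDerivWithin_le
      (f := fun y => f y - (fderiv ℝ f x₀ y + (1 / 2 : ℝ) * B (y - x₀) (y - x₀)))
      (fun y hy => ((d0 y (hsub hy)).sub
        ((fderiv ℝ f x₀).hasFDerivAt.add (dq y))).hasFDerivWithinAt) b1 hx₀ hzρ
  refine le_trans (le_of_eq ?_) (h.trans (le_of_eq (by rw [← hρ]; ring)))
  rw [Real.norm_eq_abs]
  congr 1
  simp only [map_sub (fderiv ℝ f x₀), sub_self, map_zero]
  ring

theorem complex_quadratic_re_identity (P Q R S : ℝ) (u v : ℂ) :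
    ((1 / 2) * ((1 / 2) * ((P : ℂ) - Complex.I * Q) - Complex.I * ((1 / 2) * ((R : ℂ) - Complex.I * S))) * u * v).re +
    ((1 / 2) * ((1 / 2) * ((P : ℂ) + Complex.I * Q) - Complex.I * ((1 / 2) * ((R : ℂ) + Complex.I * S))) * u *
      (starRingEnd ℂ) v).re =
    (1 / 2) * (u.re * v.re * P + u.re * v.im * Q + u.im * v.re * R + u.im * v.im * S) := by
  simp
  ring

theorem eq_sum_re_im_single {n : ℕ} (v : EuclideanSpace ℂ (Fin n)) :
    v = ∑ i, ((v i).re • EuclideanSpace.single i (1 : ℂ) +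
      (v i).im • EuclideanSpace.single i Complex.I) := by
  ext j
  simp [Pi.single_apply, Finset.sum_add_distrib]

theorem wdz_ofReal {n : ℕ} {f : EuclideanSpace ℂ (Fin n) → ℝ} {z : EuclideanSpace ℂ (Fin n)}
    (hf : DifferentiableAt ℝ f z) (i : Fin n) :
    wdz n (fun v => (f v : ℂ)) i z = (1 / 2) * ((fderiv ℝ f z (EuclideanSpace.single i 1) : ℂ) -
      Complex.I * (fderiv ℝ f z (EuclideanSpace.single i Complex.I) : ℂ)) := by
  have h : HasFDerivAt (fun v => (f v : ℂ)) (Complex.ofRealCLM.comp (fderiv ℝ f z)) z :=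
    Complex.ofRealCLM.hasFDerivAt.comp z hf.hasFDerivAt
  simp [wdz, h.fderiv]

theorem wdzbar_ofReal {n : ℕ} {f : EuclideanSpace ℂ (Fin n) → ℝ} {z : EuclideanSpace ℂ (Fin n)}
    (hf : DifferentiableAt ℝ f z) (i : Fin n) :
    wdzbar n (fun v => (f v : ℂ)) i z =
      (1 / 2) * ((fderiv ℝ f z (EuclideanSpace.single i 1) : ℂ) +
      Complex.I * (fderiv ℝ f z (EuclideanSpace.single i Complex.I) : ℂ)) := by
  have h : HasFDerivAt (fun v => (f v : ℂ)) (Complex.ofRealCLM.comp (fderiv ℝ f z)) z :=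
    Complex.ofRealCLM.hasFDerivAt.comp z hf.hasFDerivAt
  simp [wdzbar, h.fderiv]

theorem wdz_congr {n : ℕ} {f g : EuclideanSpace ℂ (Fin n) → ℂ} {z : EuclideanSpace ℂ (Fin n)}
    (h : f =ᶠ[nhds z] g) (i : Fin n) : wdz n f i z = wdz n g i z := by
  simp [wdz, h.fderiv_eq]

theorem hasFDerivAt_half_mul_add_ofReal {E : Type*} [NormedAddCommGroup E] [NormedSpace ℝ E]
    {G : E → E →L[ℝ] ℝ} {B : E →L[ℝ] E →L[ℝ] ℝ} {z : E} (hG : HasFDerivAt G B z) (c : ℂ) (a b : E) :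
    HasFDerivAt (fun w => (1 / 2 : ℂ) * ((G w a : ℂ) + c * (G w b : ℂ)))
      ((1 / 2 : ℂ) • (Complex.ofRealCLM.comp (B.flip a) + c • Complex.ofRealCLM.comp (B.flip b)))
      z := by
  have h (a : E) : HasFDerivAt (fun w => (G w a : ℂ)) (Complex.ofRealCLM.comp (B.flip a)) z := by
    have h1 : HasFDerivAt (fun w => G w a) (B.flip a) z := by
      refine (hG.clm_apply (hasFDerivAt_const a z)).congr_fderiv ?_
      ext u
      simp
    exact Complex.ofRealCLM.hasFDerivAt.comp z h1
  exact ((h a).add ((h b).const_mul c)).const_mul _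

theorem wdz_wdz_ofReal {n : ℕ} {f : EuclideanSpace ℂ (Fin n) → ℝ} {z : EuclideanSpace ℂ (Fin n)}
    (hf : ContDiffAt ℝ 2 f z) (i j : Fin n) :
    wdz n (fun w => wdz n (fun v => (f v : ℂ)) j w) i z =
      (1 / 2) * ((1 / 2) *
        ((fderiv ℝ (fderiv ℝ f) z (EuclideanSpace.single i 1) (EuclideanSpace.single j 1) : ℂ) -
          Complex.I * (fderiv ℝ (fderiv ℝ f) z (EuclideanSpace.single i 1)
            (EuclideanSpace.single j Complex.I) : ℂ)) -
        Complex.I * ((1 / 2) *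
        ((fderiv ℝ (fderiv ℝ f) z (EuclideanSpace.single i Complex.I)
            (EuclideanSpace.single j 1) : ℂ) -
          Complex.I * (fderiv ℝ (fderiv ℝ f) z (EuclideanSpace.single i Complex.I)
            (EuclideanSpace.single j Complex.I) : ℂ)))) := by
  have he : (fun w => wdz n (fun v => (f v : ℂ)) j w) =ᶠ[nhds z] fun w =>
      (1 / 2 : ℂ) * ((fderiv ℝ f w (EuclideanSpace.single j 1) : ℂ) +
        (-Complex.I) * (fderiv ℝ f w (EuclideanSpace.single j Complex.I) : ℂ)) := by
    filter_upwards [hf.eventually (by simp)] with w hw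
    rw [wdz_ofReal (hw.differentiableAt (by simp))]
    ring
  have hd : HasFDerivAt (fderiv ℝ f) (fderiv ℝ (fderiv ℝ f) z) z :=
    ((hf.fderiv_right (m := 1) (by norm_num)).differentiableAt (by simp)).hasFDerivAt
  rw [wdz_congr he, wdz, (hasFDerivAt_half_mul_add_ofReal hd _ _ _).fderiv]
  simp
  ring

theorem cHess_apply {n : ℕ} {f : EuclideanSpace ℂ (Fin n) → ℝ} {z : EuclideanSpace ℂ (Fin n)}
    (hf : ContDiffAt ℝ 2 f z) (i j : Fin n) :
    cHess n f z i j =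
      (1 / 2) * ((1 / 2) *
        ((fderiv ℝ (fderiv ℝ f) z (EuclideanSpace.single i 1) (EuclideanSpace.single j 1) : ℂ) +
          Complex.I * (fderiv ℝ (fderiv ℝ f) z (EuclideanSpace.single i 1)
            (EuclideanSpace.single j Complex.I) : ℂ)) -
        Complex.I * ((1 / 2) *
        ((fderiv ℝ (fderiv ℝ f) z (EuclideanSpace.single i Complex.I)
            (EuclideanSpace.single j 1) : ℂ) +
          Complex.I * (fderiv ℝ (fderiv ℝ f) z (EuclideanSpace.single i Complex.I)
            (EuclideanSpace.single j Complex.I) : ℂ)))) := by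
  have he : (fun w => wdzbar n (fun v => (f v : ℂ)) j w) =ᶠ[nhds z] fun w =>
      (1 / 2 : ℂ) * ((fderiv ℝ f w (EuclideanSpace.single j 1) : ℂ) +
        Complex.I * (fderiv ℝ f w (EuclideanSpace.single j Complex.I) : ℂ)) := by
    filter_upwards [hf.eventually (by simp)] with w hw
    rw [wdzbar_ofReal (hw.differentiableAt (by simp))]
  have hd : HasFDerivAt (fderiv ℝ f) (fderiv ℝ (fderiv ℝ f) z) z :=
    ((hf.fderiv_right (m := 1) (by norm_num)).differentiableAt (by simp)).hasFDerivAt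
  rw [cHess, Matrix.of_apply, wdz_congr he, wdz, (hasFDerivAt_half_mul_add_ofReal hd _ _ _).fderiv]
  simp
  ring

/-- The Levi form of `f` at `z`, as a complex-valued quadratic form. -/
def leviForm (n : ℕ) (f : EuclideanSpace ℂ (Fin n) → ℝ) (z v : EuclideanSpace ℂ (Fin n)) : ℂ :=
  ∑ i, ∑ j, cHess n f z i j * v i * (starRingEnd ℂ) (v j)

/-- The pluriharmonic polynomial and the Levi form together make up the second-order Taylor
polynomial. -/
theorem hpoly_add_leviForm_re {n : ℕ} {f : EuclideanSpace ℂ (Fin n) → ℝ}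
    {x₀ : EuclideanSpace ℂ (Fin n)} (hf : ContDiffAt ℝ 2 f x₀) (z : EuclideanSpace ℂ (Fin n)) :
    hpoly n f x₀ z + (leviForm n f x₀ (z - x₀)).re =
      fderiv ℝ f x₀ (z - x₀) + (1 / 2) * fderiv ℝ (fderiv ℝ f) x₀ (z - x₀) (z - x₀) := by
  set v := z - x₀ with hv
  have h1 : (∑ i, 2 * wdz n (fun v => (f v : ℂ)) i x₀ * v i).re = fderiv ℝ f x₀ v := by
    conv_rhs => rw [eq_sum_re_im_single v]
    rw [Complex.re_sum, map_sum]
    refine Finset.sum_congr rfl fun i _ => ?_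
    rw [wdz_ofReal (hf.differentiableAt (by simp))]
    simp
    ring
  have h2 : (1 / 2) * fderiv ℝ (fderiv ℝ f) x₀ v v =
      (∑ i, ∑ j, wdz n (fun w => wdz n (fun v => (f v : ℂ)) j w) i x₀ * v i * v j).re +
        (leviForm n f x₀ v).re := by
    conv_lhs => rw [eq_sum_re_im_single v]
    simp only [leviForm, Complex.re_sum, ← Finset.sum_add_distrib]
    rw [map_sum (fderiv ℝ (fderiv ℝ f) x₀), sum_apply, Finset.mul_sum]
    refine Finset.sum_congr rfl fun i _ => ?_
    rw [map_sum, Finset.mul_sum]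
    refine Finset.sum_congr rfl fun j _ => ?_
    rw [wdz_wdz_ofReal hf, cHess_apply hf, complex_quadratic_re_identity]
    simp only [map_add, map_smul, add_apply, smul_apply, smul_eq_mul]
    ring
  rw [h2, ← h1]
  simp only [hpoly, ← hv]
  ring

theorem leviForm_bounds {n : ℕ} {f : EuclideanSpace ℂ (Fin n) → ℝ}
    {x₀ : EuclideanSpace ℂ (Fin n)} {c : ℝ}
    (h : (cHess n f x₀ - (c : ℂ) • 1).PosSemidef) (v : EuclideanSpace ℂ (Fin n)) :
    c * ‖v‖ ^ 2 ≤ (leviForm n f x₀ v).re ∧ (leviForm n f x₀ v).im = 0 := by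
  have h0 := h.dotProduct_mulVec_nonneg (star v.ofLp)
  have h1 : star (star v.ofLp) ⬝ᵥ (cHess n f x₀ - (c : ℂ) • 1).mulVec (star v.ofLp) =
      leviForm n f x₀ v - ((c * ‖v‖ ^ 2 : ℝ) : ℂ) := by
    rw [Matrix.sub_mulVec, dotProduct_sub]
    congr 1
    · simp only [leviForm, dotProduct, Matrix.mulVec, Finset.mul_sum, star_star, Pi.star_apply]
      refine Finset.sum_congr rfl fun i _ => Finset.sum_congr rfl fun j _ => ?_
      simp only [starRingEnd_apply]
      ring
    · rw [Matrix.smul_mulVec, Matrix.one_mulVec, dotProduct_smul, EuclideanSpace.norm_sq_eq]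
      simp [dotProduct, Complex.mul_conj, Complex.normSq_eq_norm_sq]
  rw [h1, Complex.le_def] at h0
  simp only [Complex.zero_re, Complex.zero_im, Complex.sub_re, Complex.sub_im, Complex.ofReal_re,
    Complex.ofReal_im] at h0
  exact ⟨by linarith [h0.1], by linarith [h0.2]⟩

theorem leviForm_re_smul {n : ℕ} (f : EuclideanSpace ℂ (Fin n) → ℝ)
    (x₀ : EuclideanSpace ℂ (Fin n)) (t : ℝ) (v : EuclideanSpace ℂ (Fin n)) :
    (leviForm n f x₀ (t • v)).re = t ^ 2 * (leviForm n f x₀ v).re := by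
  have h : leviForm n f x₀ (t • v) = ((t ^ 2 : ℝ) : ℂ) * leviForm n f x₀ v := by
    simp only [leviForm, Finset.mul_sum]
    refine Finset.sum_congr rfl fun i _ => Finset.sum_congr rfl fun j _ => ?_
    simp
    ring
  rw [h, Complex.re_ofReal_mul]

/-- The cubic error is controlled by `μ ^ (3/2)` once `‖v‖ ^ 2 ≲ μ`. -/
theorem norm_and_cube_le {C₀ s x : ℝ} (hC₀ : 1 < C₀) (hs : 0 ≤ s) (hx : 0 ≤ x)
    (h : x ^ 2 ≤ 5 / 2 * C₀ * s ^ 2) : x ≤ 2 * C₀ * s ∧ C₀ * x ^ 3 ≤ 5 * C₀ ^ 3 * s ^ 3 := by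
  have h1 : x ≤ 2 * C₀ * s := by
    refine abs_le_of_sq_le_sq' ?_ (by positivity) |>.2
    nlinarith [mul_nonneg (sq_nonneg s) (by nlinarith : (0 : ℝ) ≤ 4 * C₀ ^ 2 - 5 / 2 * C₀)]
  refine ⟨h1, ?_⟩
  calc C₀ * x ^ 3 = C₀ * (x ^ 2 * x) := by ring
    _ ≤ C₀ * ((5 / 2 * C₀ * s ^ 2) * (2 * C₀ * s)) := by gcongr
    _ = 5 * C₀ ^ 3 * s ^ 3 := by ring

/-- Sublevel sets of a perturbation of a `2`-homogeneous coercive function `q` are comparable to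
the sublevel sets of `q`. -/
theorem sublevel_comparable {E : Type*} [NormedAddCommGroup E] [NormedSpace ℝ E]
    {q g : E → ℝ} {x₀ : E} {C₀ C₁ δ μ : ℝ} (hC₀ : 1 < C₀) (hC₁ : C₁ = 2 + 5 * C₀ ^ 3)
    (hqs : ∀ (t : ℝ) v, q (t • v) = t ^ 2 * q v) (hql : ∀ v, ‖v‖ ^ 2 ≤ C₀ * q v)
    (hgc : ContinuousOn g (ball x₀ (1 / (2 * C₀ ^ 2))))
    (hg : ∀ z ∈ ball x₀ (1 / (2 * C₀ ^ 2)), |g z - q (z - x₀)| ≤ 2 * δ + C₀ * ‖z - x₀‖ ^ 3)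
    (hδ : 0 ≤ δ) (hδμ : 4 * C₁ * δ ≤ μ) (hμ : μ ≤ (1 / (4 * C₁)) ^ 2) :
    ((fun y => x₀ + (1 - C₁ * (δ / μ + √μ)) • (y - x₀)) '' {z | q (z - x₀) ≤ μ} ⊆
      {z | z ∈ ball x₀ (1 / (2 * C₀ ^ 2)) ∧ g z ≤ μ}) ∧
    ({z | z ∈ ball x₀ (1 / (2 * C₀ ^ 2)) ∧ g z ≤ μ} ⊆
      (fun y => x₀ + (1 + C₁ * (δ / μ + √μ)) • (y - x₀)) '' {z | q (z - x₀) ≤ μ}) ∧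
    ∀ z ∈ frontier {z | z ∈ ball x₀ (1 / (2 * C₀ ^ 2)) ∧ g z ≤ μ}, g z = μ := by
  have hC₀3 : 1 < C₀ ^ 3 := one_lt_pow₀ hC₀ (by norm_num)
  have hC₁7 : 7 < C₁ := by linarith
  have hμ0 : 0 ≤ μ := le_trans (by positivity) hδμ
  set s := √μ with hs
  have hs0 : 0 ≤ s := Real.sqrt_nonneg _
  have hs2 : s ^ 2 = μ := Real.sq_sqrt hμ0
  have hsC : C₁ * s ≤ 1 / 4 := by
    have : s ≤ 1 / (4 * C₁) := Real.sqrt_le_iff.2 ⟨by positivity, hμ⟩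
    calc C₁ * s ≤ C₁ * (1 / (4 * C₁)) := by gcongr
      _ = 1 / 4 := by field_simp
  set d := δ / μ with hd
  have hd0 : 0 ≤ d := by positivity
  have hdμ : d * μ = δ := by
    rcases hμ0.eq_or_lt with h | h
    · have : δ = 0 := by
        rw [← h] at hδμ
        nlinarith
      rw [← h, this, mul_zero]
    · rw [hd, div_mul_cancel₀ _ h.ne']
  have hdC : C₁ * d ≤ 1 / 4 := by
    rcases hμ0.eq_or_lt with h | h
    · rw [hd, ← h]
      norm_num
    · rw [hd, ← mul_div_assoc, div_le_iff₀ h]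
      linarith
  have hγ : 0 ≤ C₁ * (d + s) := by positivity
  have hr : 2 * C₀ * s < 1 / (2 * C₀ ^ 2) := by
    rw [lt_div_iff₀ (by positivity)]
    nlinarith
  have hsmall : ∀ v : E, q v ≤ 5 / 2 * μ →
      ‖v‖ ≤ 2 * C₀ * s ∧ C₀ * ‖v‖ ^ 3 ≤ 5 * C₀ ^ 3 * s ^ 3 := fun v hv => by
    refine norm_and_cube_le hC₀ hs0 (norm_nonneg v) ((hql v).trans ?_)
    rw [hs2]
    nlinarith
  have herr : ∀ v : E, q v ≤ 5 / 2 * μ → 2 * δ + C₀ * ‖v‖ ^ 3 ≤ C₁ * (d + s) * μ := fun v hv => by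
    have h := (hsmall v hv).2
    have h1 : s ^ 3 = s * μ := by rw [← hs2]; ring
    rw [h1] at h
    have h2 : C₁ * (d + s) * μ = C₁ * δ + C₁ * (s * μ) := by rw [← hdμ]; ring
    have h3 : 0 ≤ s * μ := by positivity
    have h4 : 5 * C₀ ^ 3 * (s * μ) ≤ C₁ * (s * μ) := by gcongr; linarith
    nlinarith
  have hSq : ∀ z, z ∈ ball x₀ (1 / (2 * C₀ ^ 2)) → g z ≤ μ → q (z - x₀) ≤ 5 / 2 * μ := by
    intro z hz hgz
    have h1 := (abs_le.1 (hg z hz)).1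
    have hv : ‖z - x₀‖ < 1 / (2 * C₀ ^ 2) := by simpa [dist_eq_norm] using hz
    rw [lt_div_iff₀ (by positivity)] at hv
    have h2 : C₀ * ‖z - x₀‖ ^ 3 ≤ q (z - x₀) / 2 := by
      have h3 := hql (z - x₀)
      have h4 : C₀ * ‖z - x₀‖ * (‖z - x₀‖ ^ 2) ≤ C₀ * ‖z - x₀‖ * (C₀ * q (z - x₀)) := by gcongr
      have h5 : 0 ≤ q (z - x₀) :=
        nonneg_of_mul_nonneg_right ((sq_nonneg _).trans h3) (by linarith)
      nlinarith
    nlinarith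
  refine ⟨?_, ?_, ?_⟩
  · rintro _ ⟨y, hy, rfl⟩
    simp only [Set.mem_ofPred_eq] at hy
    set t := 1 - C₁ * (d + s) with ht
    have ht1 : t ≤ 1 := by linarith
    have ht0 : 0 ≤ t := by linarith
    have hqy : 0 ≤ q (y - x₀) :=
      nonneg_of_mul_nonneg_right ((sq_nonneg _).trans (hql (y - x₀))) (by linarith)
    have htt : t ^ 2 ≤ t := by nlinarith
    have hqt : q (t • (y - x₀)) ≤ t * μ := by
      rw [hqs]
      gcongr
    have hq5 : q (t • (y - x₀)) ≤ 5 / 2 * μ := hqt.trans (by gcongr; linarith)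
    have hb : x₀ + t • (y - x₀) ∈ ball x₀ (1 / (2 * C₀ ^ 2)) := by
      simpa [dist_eq_norm] using ((hsmall _ hq5).1.trans_lt hr)
    refine ⟨hb, ?_⟩
    have h1 := (abs_le.1 (hg _ hb)).2
    rw [add_sub_cancel_left] at h1
    have h2 := herr _ hq5
    have h3 : t * μ + C₁ * (d + s) * μ = μ := by rw [ht]; ring
    linarith
  · rintro z ⟨hz, hgz⟩
    set T := 1 + C₁ * (d + s) with hT
    have hT1 : 1 ≤ T := by linarith
    refine ⟨x₀ + T⁻¹ • (z - x₀), ?_, ?_⟩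
    · simp only [Set.mem_ofPred_eq, add_sub_cancel_left]
      have h1 := (abs_le.1 (hg _ hz)).1
      have h2 := herr _ (hSq z hz hgz)
      have h3 : q (z - x₀) ≤ T * μ := by
        have : T * μ = μ + C₁ * (d + s) * μ := by rw [hT]; ring
        linarith
      rw [hqs, inv_pow, inv_mul_le_iff₀ (by positivity)]
      refine h3.trans ?_
      gcongr
      nlinarith
    · simp only [add_sub_cancel_left]
      rw [smul_smul, mul_inv_cancel₀ (by linarith), one_smul, add_sub_cancel]
  · intro z hz
    have hsub : {z | z ∈ ball x₀ (1 / (2 * C₀ ^ 2)) ∧ g z ≤ μ} ⊆ closedBall x₀ (2 * C₀ * s) := by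
      rintro y ⟨hy, hgy⟩
      simpa [dist_eq_norm] using (hsmall _ (hSq y hy hgy)).1
    have hzb : z ∈ ball x₀ (1 / (2 * C₀ ^ 2)) :=
      closedBall_subset_ball hr (closure_minimal hsub isClosed_closedBall hz.1)
    have hnb := isOpen_ball.mem_nhds hzb
    have hcont : ContinuousAt g z := hgc.continuousAt hnb
    refine le_antisymm ?_ ?_
    · by_contra! hlt
      have hev := hcont.eventually (lt_mem_nhds hlt)
      obtain ⟨y, hy, hyS⟩ := mem_closure_iff_nhds.1 hz.1 _ hev
      exact absurd hyS.2 (not_le.2 hy)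
    · by_contra! hlt
      refine hz.2 (mem_interior_iff_mem_nhds.2 ?_)
      filter_upwards [hnb, hcont.eventually (gt_mem_nhds hlt)] with y hy hy'
      exact ⟨hy, hy'.le⟩

/-- sections of functions uniformly close to a smooth strictly
plurisubharmonic function `w₀` are comparable to the ellipsoids `E_μ(x₀)` of `w₀`. -/
theorem sections_comparable_to_ellipsoids
    (n : ℕ) (hn : 1 ≤ n) (C₀ : ℝ) (hC₀ : 1 < C₀) :
    ∃ C₁ μ₀ : ℝ, 0 < C₁ ∧ 0 < μ₀ ∧
    ∀ w₀ : EuclideanSpace ℂ (Fin n) → ℝ,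
      -- w₀ ∈ C³(B₁)
      ContDiffOn ℝ 3 w₀ (ball 0 1) →
      -- (1/C₀)·I ≤ ((w₀)_{i j̄}) ≤ C₀·I on B_{0.99}
      (∀ z ∈ ball (0 : EuclideanSpace ℂ (Fin n)) (0.99 : ℝ),
        (cHess n w₀ z - ((1 / C₀ : ℝ) : ℂ) • 1).PosSemidef ∧
        ((C₀ : ℂ) • 1 - cHess n w₀ z).PosSemidef) →
      -- |D³ w₀| ≤ C₀ on B_{0.99}
      (∀ z ∈ ball (0 : EuclideanSpace ℂ (Fin n)) (0.99 : ℝ),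
        ‖iteratedFDeriv ℝ 3 w₀ z‖ ≤ C₀) →
    ∀ δ : ℝ, 0 ≤ δ →
    ∀ φ₀ : EuclideanSpace ℂ (Fin n) → ℝ,
      -- φ₀ continuous on B₁ with |φ₀ − w₀| ≤ δ on B_{0.95}
      ContinuousOn φ₀ (ball 0 1) →
      (∀ z ∈ ball (0 : EuclideanSpace ℂ (Fin n)) (0.95 : ℝ), |φ₀ z - w₀ z| ≤ δ) →
    ∀ x₀ : EuclideanSpace ℂ (Fin n), ‖x₀‖ + 1 / (2 * C₀ ^ 2) ≤ 0.95 →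
    ∀ μ : ℝ, 4 * C₁ * δ ≤ μ → μ ≤ μ₀ →
      -- (1 − C₁γ) E_μ(x₀) ⊆ S ⊆ (1 + C₁γ) E_μ(x₀), with γ = δ/μ + √μ
      ((fun y => x₀ + (1 - C₁ * (δ / μ + Real.sqrt μ)) • (y - x₀)) '' Emu n w₀ x₀ μ
        ⊆ Sset n w₀ φ₀ x₀ μ C₀) ∧
      (Sset n w₀ φ₀ x₀ μ C₀ ⊆
        (fun y => x₀ + (1 + C₁ * (δ / μ + Real.sqrt μ)) • (y - x₀)) '' Emu n w₀ x₀ μ) ∧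
      -- (φ₀ − h_{x₀})(z) = φ₀(x₀) + μ on ∂S
      (∀ z ∈ frontier (Sset n w₀ φ₀ x₀ μ C₀), φ₀ z - hpoly n w₀ x₀ z = φ₀ x₀ + μ) := by
  have hC₀0 : 0 < C₀ := by linarith
  have hC₁0 : 0 < 2 + 5 * C₀ ^ 3 := by positivity
  refine ⟨2 + 5 * C₀ ^ 3, (1 / (4 * (2 + 5 * C₀ ^ 3))) ^ 2, hC₁0, by positivity, ?_⟩
  intro w₀ hw hH hD δ hδ φ₀ hφc hφ x₀ hx₀ μ hδμ hμ
  set r : ℝ := 1 / (2 * C₀ ^ 2) with hr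
  have hr0 : 0 < r := by positivity
  have hball : ball x₀ r ⊆ ball 0 0.95 := ball_subset_ball' (by simpa [add_comm] using hx₀)
  have h1 : ball (0 : EuclideanSpace ℂ (Fin n)) 0.95 ⊆ ball 0 1 :=
    ball_subset_ball (by norm_num)
  have h99 : ball (0 : EuclideanSpace ℂ (Fin n)) 0.95 ⊆ ball 0 0.99 :=
    ball_subset_ball (by norm_num)
  have hx₀r : x₀ ∈ ball x₀ r := mem_ball_self hr0
  have hw2 : ContDiffAt ℝ 2 w₀ x₀ :=
    (hw.contDiffAt (isOpen_ball.mem_nhds (h1 (hball hx₀r)))).of_le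
      (by exact_mod_cast (by norm_num : (2 : ℕ) ≤ 3))
  have hlevi := leviForm_bounds (hH x₀ (h99 (hball hx₀r))).1
  have hE : Emu n w₀ x₀ μ = {z | (leviForm n w₀ x₀ (z - x₀)).re ≤ μ} := by
    ext z
    change leviForm n w₀ x₀ (z - x₀) ≤ (μ : ℂ) ↔ _
    simp [Complex.le_def, (hlevi (z - x₀)).2]
  have hS : Sset n w₀ φ₀ x₀ μ C₀ =
      {z | z ∈ ball x₀ r ∧ φ₀ z - hpoly n w₀ x₀ z - φ₀ x₀ ≤ μ} := by
    ext z
    simp only [Sset, Set.mem_ofPred_eq, ← hr, sub_le_iff_le_add']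
  have hmain := sublevel_comparable (q := fun v => (leviForm n w₀ x₀ v).re)
    (g := fun z => φ₀ z - hpoly n w₀ x₀ z - φ₀ x₀) (x₀ := x₀) hC₀ rfl
    (leviForm_re_smul w₀ x₀)
    (fun v => by
      have := (hlevi v).1
      rwa [one_div, inv_mul_le_iff₀ hC₀0] at this)
    (((hφc.mono (hball.trans h1)).sub (Continuous.continuousOn (by
      unfold hpoly
      fun_prop))).sub continuousOn_const)
    (fun z hz => by
      have ht := abs_sub_second_taylor_le (hw.mono (hball.trans h1))
        (fun x hx => hD x (h99 (hball hx))) hz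
      have he := hpoly_add_leviForm_re hw2 z
      have ha := abs_le.1 (hφ z (hball hz))
      have hb := abs_le.1 (hφ x₀ (hball hx₀r))
      rw [abs_le] at ht ⊢
      constructor <;> linarith [ht.1, ht.2, ha.1, ha.2, hb.1, hb.2])
    hδ hδμ hμ
  rw [hE, hS]
  refine ⟨hmain.1, hmain.2.1, fun z hz => ?_⟩
  have : φ₀ z - hpoly n w₀ x₀ z - φ₀ x₀ = μ := hmain.2.2 z hz
  linarith
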